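/- Let M ≥ 2 and k ≥ 3 be integers such that the critical strip S_M^k exists, i.e. q_{M+1}·k + (M+2)·log 3 < q_M·k − (M+1)·log 3. Then for every integer j ≥ 0 there exists exactly one complex number s satisfying q_M·k − (M+1)·log 3 < Re(s) < q_M·k + (M+1)·log 3, 2πj/(log(M+1) − log M) < Im(s) < 2π(j+1)/(log(M+1) − log M), and iteratedDeriv k riemannZeta s = 0. -/

import Mathlib

/-- `q M = log(log M / log(M+1)) / log(M/(M+1))`, the slope of the `M`-th critical line. -/
noncomputable def q (M : ℕ) : ℝ :=
  Real.log (Real.log M / Real.log ((M : ℝ) + 1)) / Real.log ((M : ℝ) / ((M : ℝ) + 1))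

lemma log_nat_pos {n : ℕ} (hn : 2 ≤ n) : 0 < Real.log n :=
  Real.log_pos (by exact_mod_cast (by omega : 1 < n))

lemma L_pos {n : ℕ} (hn : 2 ≤ n) : Real.log n < Real.log ((n : ℝ) + 1) :=
  Real.log_lt_log (by positivity) (by linarith)

lemma q_eq {n : ℕ} (hn : 2 ≤ n) : q n * (Real.log ((n : ℝ) + 1) - Real.log n) =
    Real.log (Real.log ((n : ℝ) + 1)) - Real.log (Real.log n) := by
  have h1 := log_nat_pos hn
  have h2 := L_pos hn
  have h3 : (n : ℝ) ≠ 0 := by positivity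
  unfold q
  rw [Real.log_div h1.ne' (by linarith), Real.log_div h3 (by positivity)]
  have : Real.log n - Real.log ((n : ℝ) + 1) ≠ 0 := by linarith
  field_simp
  ring

lemma d_pos {n : ℕ} (hn : 2 ≤ n) {x : ℝ} (hx : x ∈ Set.Icc (0 : ℝ) 1) :
    0 < Real.log n + x * (Real.log ((n : ℝ) + 1) - Real.log n) := by
  have h1 := log_nat_pos hn
  have h2 := L_pos hn
  have := mul_nonneg hx.1 (sub_nonneg.mpr h2.le)
  linarith

lemma q_cont {n : ℕ} (hn : 2 ≤ n) : ContinuousOn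
    (fun x : ℝ => (Real.log n + x * (Real.log ((n : ℝ) + 1) - Real.log n))⁻¹) (Set.uIcc 0 1) := by
  rw [Set.uIcc_of_le zero_le_one]
  exact ContinuousOn.inv₀ (by fun_prop) (fun x hx => (d_pos hn hx).ne')

lemma q_intble {n : ℕ} (hn : 2 ≤ n) : IntervalIntegrable
    (fun x : ℝ => (Real.log n + x * (Real.log ((n : ℝ) + 1) - Real.log n))⁻¹)
    MeasureTheory.volume 0 1 :=
  (q_cont hn).intervalIntegrable

lemma q_int {n : ℕ} (hn : 2 ≤ n) :
    q n = ∫ x in (0 : ℝ)..1, (Real.log n + x * (Real.log ((n : ℝ) + 1) - Real.log n))⁻¹ := by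
  have h2 := L_pos hn
  set a := Real.log n with ha
  set b := Real.log ((n : ℝ) + 1) with hb
  have hne : b - a ≠ 0 := by linarith
  rw [intervalIntegral.integral_eq_sub_of_hasDerivAt
    (f := fun x => Real.log (a + x * (b - a)) / (b - a)) _ (q_intble hn)]
  · have := q_eq hn
    rw [← ha, ← hb] at this
    rw [eq_div_of_mul_eq hne this]
    simp [sub_div]
  · intro x hx
    rw [Set.uIcc_of_le zero_le_one] at hx
    have hp := d_pos hn hx
    rw [← ha, ← hb] at hp
    have h1 : HasDerivAt (fun x : ℝ => a + x * (b - a)) (b - a) x := by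
      simpa using ((hasDerivAt_id x).mul_const (b - a)).const_add a
    have := (h1.log hp.ne').div_const (b - a)
    exact this.congr_deriv (by rw [div_right_comm, div_self hne, one_div])

lemma q_pos {n : ℕ} (hn : 2 ≤ n) : 0 < q n := by
  have h1 := log_nat_pos hn
  have h2 := L_pos hn
  have h := q_eq hn
  have : 0 < Real.log (Real.log ((n : ℝ) + 1)) - Real.log (Real.log n) :=
    sub_pos.mpr (Real.log_lt_log h1 h2)
  rw [← h] at this
  exact pos_of_mul_pos_left this (by linarith)

lemma d_mono {n : ℕ} (hn : 2 ≤ n) {x : ℝ} (hx : x ∈ Set.Icc (0 : ℝ) 1) :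
    Real.log n + x * (Real.log ((n : ℝ) + 1) - Real.log n) ≤
    Real.log ((n + 1 : ℕ) : ℝ) +
      x * (Real.log (((n + 1 : ℕ) : ℝ) + 1) - Real.log ((n + 1 : ℕ) : ℝ)) := by
  have h1 := L_pos hn
  have h2 := L_pos (n := n + 1) (by omega)
  push_cast at *
  nlinarith [mul_nonneg hx.1 (sub_nonneg.mpr h2.le),
    mul_nonneg (sub_nonneg.mpr hx.2) (sub_nonneg.mpr h1.le)]

lemma q_anti {n : ℕ} (hn : 2 ≤ n) : q (n + 1) ≤ q n := by
  rw [q_int hn, q_int (n := n + 1) (by omega)]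
  apply intervalIntegral.integral_mono_on zero_le_one (q_intble (by omega)) (q_intble hn)
  intro x hx
  exact inv_anti₀ (d_pos hn hx) (d_mono hn hx)

lemma q_anti' {n m : ℕ} (hn : 2 ≤ n) (h : n ≤ m) : q m ≤ q n := by
  induction m, h using Nat.le_induction with
  | base => exact le_rfl
  | succ m hm ih => exact (q_anti (by omega)).trans ih

/-- concavity of log on three consecutive integers -/
lemma log_conc (x : ℝ) (hx : 1 < x) :
    Real.log x + Real.log (x + 1 + 1) ≤ 2 * Real.log (x + 1) := by
  rw [← Real.log_mul (by positivity) (by positivity), ← Real.log_rpow (by positivity)]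
  apply Real.log_le_log (by positivity)
  norm_num
  nlinarith

lemma log_ratio (x : ℝ) (hx : 2 ≤ x) :
    2 * (Real.log (x + 1) - Real.log x) ≤ 3 * (Real.log (x + 1 + 1) - Real.log (x + 1)) := by
  have h : Real.log ((x + 1) ^ 5) ≤ Real.log (x ^ 2 * (x + 1 + 1) ^ 3) := by
    apply Real.log_le_log (by positivity)
    nlinarith [mul_nonneg (sub_nonneg.mpr hx) (sub_nonneg.mpr hx),
      pow_nonneg (sub_nonneg.mpr hx) 3, pow_nonneg (sub_nonneg.mpr hx) 4,
      pow_nonneg (sub_nonneg.mpr hx) 5]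
  rw [Real.log_mul (by positivity) (by positivity), Real.log_pow, Real.log_pow, Real.log_pow] at h
  push_cast at h
  linarith

lemma log_half (x : ℝ) (hx : 2 ≤ x) : Real.log (x + 1 + 1) ≤ 2 * Real.log x := by
  rw [← Real.log_rpow (by positivity)]
  apply Real.log_le_log (by positivity)
  norm_num
  nlinarith

lemma inv_conv {a b c : ℝ} (ha : 0 < a) (hb : 0 < b) (hc : 0 < c) (h : a + c ≤ 2 * b) :
    2 * b⁻¹ ≤ a⁻¹ + c⁻¹ := by
  have h1 : b⁻¹ ≤ ((a + c) / 2)⁻¹ := inv_anti₀ (by positivity) (by linarith)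
  have h2 : 2 * ((a + c) / 2)⁻¹ ≤ a⁻¹ + c⁻¹ := by
    rw [← sub_nonneg]
    have : a⁻¹ + c⁻¹ - 2 * ((a + c) / 2)⁻¹ = (a - c) ^ 2 / (a * c * (a + c)) := by
      field_simp; ring
    rw [this]; positivity
  linarith

lemma inv_third {a b c : ℝ} (ha : 0 < a) (hb : 0 < b) (hc : 0 < c)
    (hab : a ≤ b) (hac : c ≤ 2 * a) (h : 2 * (b - a) ≤ 3 * (c - b)) :
    a⁻¹ - b⁻¹ ≤ 3 * (b⁻¹ - c⁻¹) := by
  have e1 : a⁻¹ - b⁻¹ = (b - a) / (a * b) := by field_simp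
  have e2 : b⁻¹ - c⁻¹ = (c - b) / (b * c) := by field_simp
  rw [e1, e2, mul_div_assoc', div_le_div_iff₀ (by positivity) (by positivity)]
  have : (b - a) * c ≤ 3 * (c - b) * a := by
    nlinarith [mul_le_mul_of_nonneg_left hac (sub_nonneg.mpr hab)]
  nlinarith [mul_le_mul_of_nonneg_left this hb.le]

lemma q_convex {n : ℕ} (hn : 2 ≤ n) : 2 * q (n + 1) ≤ q n + q (n + 1 + 1) := by
  rw [q_int hn, q_int (n := n + 1) (by omega), q_int (n := n + 1 + 1) (by omega),
    ← intervalIntegral.integral_const_mul,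
    ← intervalIntegral.integral_add (q_intble hn) (q_intble (by omega))]
  apply intervalIntegral.integral_mono_on zero_le_one ((q_intble (by omega)).const_mul 2)
    ((q_intble hn).add (q_intble (by omega)))
  intro x hx
  apply inv_conv (d_pos hn hx) (d_pos (by omega) hx) (d_pos (by omega) hx)
  have hn' : (2 : ℝ) ≤ n := by exact_mod_cast hn
  have h1 := log_conc n (by linarith)
  have h2 := log_conc (n + 1) (by linarith)
  push_cast
  nlinarith [mul_nonneg hx.1 (sub_nonneg.mpr h2),
    mul_nonneg (sub_nonneg.mpr hx.2) (sub_nonneg.mpr h1)]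

lemma q_third {n : ℕ} (hn : 2 ≤ n) : q n - q (n + 1) ≤ 3 * (q (n + 1) - q (n + 1 + 1)) := by
  rw [q_int hn, q_int (n := n + 1) (by omega), q_int (n := n + 1 + 1) (by omega),
    ← intervalIntegral.integral_sub (q_intble hn) (q_intble (by omega)),
    ← intervalIntegral.integral_sub (q_intble (by omega)) (q_intble (by omega)),
    ← intervalIntegral.integral_const_mul]
  apply intervalIntegral.integral_mono_on zero_le_one ((q_intble hn).sub (q_intble (by omega)))
    (((q_intble (by omega)).sub (q_intble (by omega))).const_mul 3)
  intro x hx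
  have hn' : (2 : ℝ) ≤ n := by exact_mod_cast hn
  apply inv_third (d_pos hn hx) (d_pos (by omega) hx) (d_pos (by omega) hx) (d_mono hn hx)
  · have h1 := log_half n (by linarith)
    have h2 := log_half (n + 1) (by linarith)
    push_cast
    nlinarith [mul_nonneg hx.1 (sub_nonneg.mpr h2),
      mul_nonneg (sub_nonneg.mpr hx.2) (sub_nonneg.mpr h1)]
  · have h1 := log_ratio n (by linarith)
    have h2 := log_ratio (n + 1) (by linarith)
    push_cast
    nlinarith [mul_nonneg hx.1 (sub_nonneg.mpr h2),
      mul_nonneg (sub_nonneg.mpr hx.2) (sub_nonneg.mpr h1)]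
/-- The `n`-th term of the Dirichlet series of `(-1)^k ζ^(k)`. -/
noncomputable def zT (k n : ℕ) (s : ℂ) : ℂ :=
  ((Real.log n : ℝ) : ℂ) ^ k * Complex.exp (-s * ((Real.log n : ℝ) : ℂ))

/-- Absolute values of the terms. -/
noncomputable def zA (k : ℕ) (σ : ℝ) (n : ℕ) : ℝ :=
  Real.log n ^ k * Real.exp (-σ * Real.log n)

lemma norm_zT (k n : ℕ) (s : ℂ) : ‖zT k n s‖ = zA k s.re n := by
  have h : 0 ≤ Real.log n := Real.log_natCast_nonneg n
  unfold zT zA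
  generalize Real.log n = x at h
  simp [Complex.norm_exp, abs_of_nonneg h]

lemma logMul_iter (k n : ℕ) : (LSeries.logMul^[k] 1) n = (Complex.log n) ^ k := by
  induction k with
  | zero => simp
  | succ k ih => rw [Function.iterate_succ_apply', LSeries.logMul, ih, pow_succ]; ring

lemma zT_hasSum (k : ℕ) (hk : k ≠ 0) (s : ℂ) (hs : 1 < s.re) :
    HasSum (fun n => zT k n s) ((-1) ^ k * iteratedDeriv k riemannZeta s) := by
  have habs : LSeries.abscissaOfAbsConv 1 < (s.re : EReal) := by
    rw [LSeries.abscissaOfAbsConv_one]; exact_mod_cast hs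
  have h1 : iteratedDeriv k riemannZeta s = iteratedDeriv k (LSeries 1) s := by
    apply Filter.EventuallyEq.iteratedDeriv_eq
    filter_upwards [(isOpen_lt continuous_const Complex.continuous_re).mem_nhds hs] with z hz
    exact (LSeries_one_eq_riemannZeta hz).symm
  have hsum : LSeriesSummable (LSeries.logMul^[k] 1) s := by
    apply LSeriesSummable_of_abscissaOfAbsConv_lt_re
    rwa [LSeries.absicssaOfAbsConv_logPowMul]
  rw [h1, LSeries_iteratedDeriv k habs, ← mul_assoc, ← mul_pow]
  simp only [mul_neg, mul_one, neg_neg, one_pow, one_mul]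
  have h2 : (fun n => zT k n s) = LSeries.term (LSeries.logMul^[k] 1) s := by
    funext n
    rcases eq_or_ne n 0 with rfl | hn
    · simp [zT, hk]
    · rw [LSeries.term_of_ne_zero hn, logMul_iter, zT, Complex.natCast_log,
        Complex.cpow_def_of_ne_zero (by exact_mod_cast hn), div_eq_mul_inv, ← Complex.exp_neg]
      congr 2; ring
  rw [h2]
  exact hsum.hasSum

lemma zeta_iter_diffAt (k : ℕ) (s : ℂ) (hs : 1 < s.re) :
    DifferentiableAt ℂ (iteratedDeriv k riemannZeta) s := by
  have hne : s ≠ 1 := by rintro rfl; simp at hs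
  have : AnalyticAt ℂ riemannZeta s := by
    apply DifferentiableOn.analyticAt (s := {1}ᶜ)
    · intro z hz; exact (differentiableAt_riemannZeta hz).differentiableWithinAt
    · exact isOpen_compl_singleton.mem_nhds hne
  exact (this.iterated_deriv k).differentiableAt |> fun h => by rwa [← iteratedDeriv_eq_iterate] at h

lemma zA_nonneg (k : ℕ) (σ : ℝ) (n : ℕ) : 0 ≤ zA k σ n := by
  have h : 0 ≤ Real.log n := Real.log_natCast_nonneg n
  unfold zA; positivity

lemma zA_pos (k : ℕ) (σ : ℝ) {n : ℕ} (hn : 2 ≤ n) : 0 < zA k σ n := by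
  have h := log_nat_pos hn
  unfold zA; positivity

lemma zA_step (k : ℕ) (σ : ℝ) {n : ℕ} (hn : 2 ≤ n) :
    zA k σ (n + 1) = zA k σ n *
      Real.exp (-((Real.log ((n : ℝ) + 1) - Real.log n) * (σ - q n * k))) := by
  have h1 := log_nat_pos hn
  have h2 := L_pos hn
  have h3 : Real.log ((n : ℝ) + 1) =
      Real.log n * Real.exp (q n * (Real.log ((n : ℝ) + 1) - Real.log n)) := by
    rw [q_eq hn, Real.exp_sub, Real.exp_log (by linarith), Real.exp_log h1]
    field_simp
  unfold zA
  push_cast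
  nth_rewrite 1 [h3]
  rw [mul_pow, ← Real.exp_nat_mul, mul_assoc, mul_assoc, ← Real.exp_add, ← Real.exp_add]
  congr 2
  ring

lemma L_ge {n : ℕ} (hn : 2 ≤ n) :
    1 / ((n : ℝ) + 1) ≤ Real.log ((n : ℝ) + 1) - Real.log n := by
  have hn' : (0 : ℝ) < n := by positivity
  rw [← Real.log_div (by positivity) (by positivity)]
  have := Real.one_sub_inv_le_log_of_pos (x := ((n : ℝ) + 1) / n) (by positivity)
  refine le_trans (le_of_eq ?_) this
  field_simp
  ring

/-- If `c (n+1) ≤ σ - q n k` then the ratio of consecutive terms is at most `exp (-c)`. -/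
lemma zA_up (k : ℕ) (σ c : ℝ) (hc : 0 ≤ c) {n : ℕ} (hn : 2 ≤ n)
    (h : ((n : ℝ) + 1) * c ≤ σ - q n * k) :
    zA k σ (n + 1) ≤ zA k σ n * Real.exp (-c) := by
  rw [zA_step k σ hn]
  have h0 := zA_nonneg k σ n
  gcongr
  have h1 := L_ge hn
  have h2 : 0 < (n : ℝ) + 1 := by positivity
  have h3 : 1 / ((n : ℝ) + 1) * (((n : ℝ) + 1) * c) ≤
      (Real.log ((n : ℝ) + 1) - Real.log n) * (σ - q n * k) :=
    mul_le_mul h1 h (by positivity) (by linarith [L_pos hn])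
  rwa [← mul_assoc, one_div_mul_cancel h2.ne', one_mul] at h3

lemma zA_down (k : ℕ) (σ c : ℝ) (hc : 0 ≤ c) {n : ℕ} (hn : 2 ≤ n)
    (h : ((n : ℝ) + 1) * c ≤ q n * k - σ) :
    zA k σ n * Real.exp c ≤ zA k σ (n + 1) := by
  rw [zA_step k σ hn]
  have h0 := zA_nonneg k σ n
  gcongr
  have h1 := L_ge hn
  have h2 : 0 < (n : ℝ) + 1 := by positivity
  have h3 : 1 / ((n : ℝ) + 1) * (((n : ℝ) + 1) * c) ≤
      (Real.log ((n : ℝ) + 1) - Real.log n) * (q n * k - σ) :=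
    mul_le_mul h1 h (by positivity) (by linarith [L_pos hn])
  rw [← mul_assoc, one_div_mul_cancel h2.ne', one_mul] at h3
  linarith

lemma zA_bern (k : ℕ) (σ δ : ℝ) (hδ : 1 ≤ δ) {n : ℕ} (hn : 2 ≤ n)
    (h : δ ≤ σ - q n * k) :
    ((n : ℝ) + δ) * zA k σ (n + 1) ≤ n * zA k σ n := by
  rw [zA_step k σ hn]
  have h0 := zA_nonneg k σ n
  have hn' : (0 : ℝ) < n := by positivity
  set L := Real.log ((n : ℝ) + 1) - Real.log n with hL
  have hLp : 0 < L := by linarith [L_pos hn]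
  have h1 : Real.exp (-(L * (σ - q n * k))) ≤ Real.exp (-(L * δ)) := by gcongr
  have h2 : 1 + δ * (1 / n) ≤ Real.exp (L * δ) := by
    have := one_add_mul_self_le_rpow_one_add (s := 1 / (n : ℝ)) (by
      have : 0 < 1 / (n : ℝ) := by positivity
      linarith) hδ
    rw [Real.rpow_def_of_pos (by positivity)] at this
    have e : Real.log (1 + 1 / (n : ℝ)) = L := by
      rw [hL, ← Real.log_div (by positivity) (by positivity)]
      congr 1
      field_simp
    rwa [e] at this
  have h3 : ((n : ℝ) + δ) * Real.exp (-(L * δ)) ≤ n := by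
    rw [Real.exp_neg, ← div_eq_mul_inv, div_le_iff₀ (Real.exp_pos _)]
    calc (n : ℝ) + δ = n * (1 + δ * (1 / n)) := by field_simp
      _ ≤ _ := by gcongr
  calc ((n : ℝ) + δ) * (zA k σ n * Real.exp (-(L * (σ - q n * k))))
      ≤ ((n : ℝ) + δ) * (zA k σ n * Real.exp (-(L * δ))) := by gcongr
    _ = zA k σ n * (((n : ℝ) + δ) * Real.exp (-(L * δ))) := by ring
    _ ≤ zA k σ n * n := by gcongr
    _ = _ := by ring

lemma tail_partial (a : ℕ → ℝ) (δ : ℝ) (m : ℕ)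
    (h : ∀ n, m ≤ n → ((n : ℝ) + δ) * a (n + 1) ≤ n * a n) (K : ℕ) :
    (δ - 1) * ∑ i ∈ Finset.range K, a (i + (m + 1)) ≤ m * a m - ((m + K : ℕ) : ℝ) * a (m + K) := by
  induction K with
  | zero => simp
  | succ K ih =>
    rw [Finset.sum_range_succ, mul_add]
    have := h (m + K) (by omega)
    rw [show K + (m + 1) = m + K + 1 by omega, show m + (K + 1) = m + K + 1 by omega]
    push_cast at *
    linarith

lemma tail_bound (k : ℕ) (σ : ℝ) (N : ℕ) (hN : 3 ≤ N)
    (hsum : Summable (zA k σ))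
    (h1 : q N * k + ((N : ℝ) + 1) * Real.log 3 < σ)
    (h2 : (2 * (N : ℝ) + 1) * Real.log 3 < (q (N - 1) - q N) * k) :
    ∑' i, zA k σ (i + (N + 1)) < zA k σ N / 2 := by
  have hl := Real.log_three_gt_d9
  have hN' : (3 : ℝ) ≤ N := by exact_mod_cast hN
  have hk : (0 : ℝ) ≤ k := by positivity
  have hq := q_third (n := N - 1) (by omega)
  rw [show N - 1 + 1 = N by omega] at hq
  set δ := σ - q (N + 1) * k with hδ
  have hδ1 : 1.35 * ((N : ℝ) + 2) ≤ δ := by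
    have := mul_le_mul_of_nonneg_right hq hk
    nlinarith
  -- first ratio
  have r1 : zA k σ (N + 1) < zA k σ N * (1 / 3) := by
    have hp := zA_pos k σ (n := N) (by omega)
    rw [zA_step k σ (by omega)]
    gcongr
    rw [one_div, ← Real.exp_log (show (0 : ℝ) < 3 by norm_num), ← Real.exp_neg, Real.exp_lt_exp,
      neg_lt_neg_iff]
    have hg := L_ge (n := N) (by omega)
    have h5 : 0 < (N : ℝ) + 1 := by positivity
    calc Real.log 3 = 1 / ((N : ℝ) + 1) * (((N : ℝ) + 1) * Real.log 3) := by field_simp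
      _ < 1 / ((N : ℝ) + 1) * (σ - q N * k) := by gcongr; linarith
      _ ≤ _ := by
        gcongr
        have : 0 < ((N : ℝ) + 1) * Real.log 3 := by positivity
        linarith
  have hexp : Real.exp (-1.35) ≤ 0.265 := by
    rw [Real.exp_neg, inv_le_comm₀ (Real.exp_pos _) (by norm_num)]
    have e1 := Real.exp_one_gt_d9
    have e2 := Real.quadratic_le_exp_of_nonneg (x := 0.35) (by norm_num)
    rw [show (1.35 : ℝ) = 1 + 0.35 by norm_num, Real.exp_add]
    have : (2.7182818283 : ℝ) * (1 + 0.35 + 0.35 ^ 2 / 2) ≤ Real.exp 1 * Real.exp 0.35 := by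
      gcongr
    refine le_trans ?_ this
    norm_num
  have r2 : zA k σ (N + 2) ≤ zA k σ (N + 1) * 0.265 := by
    have := zA_up k σ 1.35 (by norm_num) (n := N + 1) (by omega) (by push_cast; linarith)
    have h0 := zA_nonneg k σ (N + 1)
    exact this.trans (by gcongr)
  have r3 : (δ - 1) * ∑' i, zA k σ (i + (N + 3)) ≤ ((N : ℝ) + 2) * zA k σ (N + 2) := by
    rw [← tsum_mul_left]
    apply Real.tsum_le_of_sum_range_le
    · intro n
      exact mul_nonneg (by nlinarith) (zA_nonneg _ _ _)
    · intro K
      rw [← Finset.mul_sum]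
      have := tail_partial (zA k σ) δ (N + 2) (fun n hn => zA_bern k σ δ (by nlinarith) (by omega)
        (by
          have := q_anti' (n := N + 1) (m := n) (by omega) (by omega)
          have := mul_le_mul_of_nonneg_right this hk
          linarith)) K
      have h0 : 0 ≤ ((N + 2 + K : ℕ) : ℝ) * zA k σ (N + 2 + K) :=
        mul_nonneg (by positivity) (zA_nonneg _ _ _)
      push_cast at this h0 ⊢
      linarith
  have split : ∑' i, zA k σ (i + (N + 1)) =
      zA k σ (N + 1) + zA k σ (N + 2) + ∑' i, zA k σ (i + (N + 3)) := by
    have := ((summable_nat_add_iff (N + 1)).mpr hsum).sum_add_tsum_nat_add 2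
    rw [← this]
    simp only [Finset.sum_range_succ, Finset.sum_range_zero, zero_add]
    congr 1
    · rw [show 1 + (N + 1) = N + 2 by omega]
    · exact tsum_congr fun i => by rw [show i + 2 + (N + 1) = i + (N + 3) by omega]
  rw [split]
  have hT : 0 ≤ ∑' i, zA k σ (i + (N + 3)) := tsum_nonneg fun i => zA_nonneg _ _ _
  have hA2 := zA_nonneg k σ (N + 2)
  -- (δ - 1) ≥ 1.15 (N+2)
  have r4 : 1.15 * ∑' i, zA k σ (i + (N + 3)) ≤ zA k σ (N + 2) := by
    have h6 : 1.15 * ((N : ℝ) + 2) ≤ δ - 1 := by linarith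
    have h7 := mul_le_mul_of_nonneg_right h6 hT
    have h8 : ((N : ℝ) + 2) * (1.15 * ∑' i, zA k σ (i + (N + 3))) ≤
        ((N : ℝ) + 2) * zA k σ (N + 2) := by linarith
    exact le_of_mul_le_mul_left h8 (by positivity)
  have hA1 := zA_nonneg k σ (N + 1)
  linarith

lemma head_bound (k : ℕ) (hk0 : k ≠ 0) (σ : ℝ) (M : ℕ) (hM : 2 ≤ M)
    (h : ∀ n, 2 ≤ n → n < M → ((n : ℝ) + 1) * Real.log 3 ≤ q n * k - σ) :
    ∑ i ∈ Finset.range M, zA k σ i ≤ zA k σ M / 2 := by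
  induction M, hM using Nat.le_induction with
  | base =>
    have := zA_nonneg k σ 2
    simp only [Finset.sum_range_succ, Finset.sum_range_zero]
    have e0 : zA k σ 0 = 0 := by simp [zA, hk0]
    have e1 : zA k σ 1 = 0 := by simp [zA, hk0]
    rw [e0, e1]; linarith
  | succ m hm ih =>
    rw [Finset.sum_range_succ]
    have h1 := ih (fun n h2 h3 => h n h2 (by omega))
    have h2 := zA_down k σ (Real.log 3) (Real.log_nonneg (by norm_num)) hm (h m hm (by omega))
    rw [Real.exp_log (by norm_num)] at h2
    linarith

/-- The main estimate. -/
lemma rest_bound (M k : ℕ) (hM : 2 ≤ M) (hk : 3 ≤ k)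
    (hex : q (M + 1) * k + ((M : ℝ) + 2) * Real.log 3 <
      q M * k - ((M : ℝ) + 1) * Real.log 3) (s : ℂ)
    (h1 : q M * k - ((M : ℝ) + 1) * Real.log 3 ≤ s.re)
    (h2 : s.re ≤ q M * k + ((M : ℝ) + 1) * Real.log 3) :
    1 < s.re ∧ ‖(-1) ^ k * iteratedDeriv k riemannZeta s - zT k M s - zT k (M + 1) s‖ <
      (‖zT k M s‖ + ‖zT k (M + 1) s‖) / 2 := by
  have hl := Real.log_three_gt_d9
  have hM' : (2 : ℝ) ≤ M := by exact_mod_cast hM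
  have hk' : (0 : ℝ) ≤ k := by positivity
  have hs : 1 < s.re := by
    have := mul_nonneg (q_pos (n := M + 1) (by omega)).le hk'
    nlinarith
  refine ⟨hs, ?_⟩
  have hS := zT_hasSum k (by omega) s hs
  have hsumN : Summable (fun n => ‖zT k n s‖) := hS.summable.norm
  have hnorm : (fun n => ‖zT k n s‖) = zA k s.re := by funext n; exact norm_zT k n s
  have hsumA : Summable (zA k s.re) := hnorm ▸ hsumN
  have htail := tail_bound k s.re (M + 1) (by omega) hsumA (by push_cast; linarith)
    (by push_cast; linarith)
  have hhead := head_bound k (by omega) s.re M hM (by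
    intro n hn hnM
    have hq1 : q (M - 1) ≤ q n := q_anti' hn (by omega)
    have hq2 := q_convex (n := M - 1) (by omega)
    rw [show M - 1 + 1 = M by omega] at hq2
    have e1 := mul_le_mul_of_nonneg_right hq1 hk'
    have e2 := mul_le_mul_of_nonneg_right hq2 hk'
    have e3 : (n : ℝ) + 1 ≤ M := by exact_mod_cast hnM
    nlinarith)
  have hsplit := hS.summable.sum_add_tsum_nat_add (M + 2)
  rw [hS.tsum_eq, Finset.sum_range_succ, Finset.sum_range_succ] at hsplit
  have hexpr : (-1) ^ k * iteratedDeriv k riemannZeta s - zT k M s - zT k (M + 1) s =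
      ∑ i ∈ Finset.range M, zT k i s + ∑' i, zT k (i + (M + 2)) s := by
    rw [← hsplit]; ring
  rw [hexpr]
  have n1 : ‖∑ i ∈ Finset.range M, zT k i s‖ ≤ ∑ i ∈ Finset.range M, zA k s.re i := by
    refine (norm_sum_le _ _).trans (le_of_eq ?_)
    simp only [norm_zT]
  have n2 : ‖∑' i, zT k (i + (M + 2)) s‖ ≤ ∑' i, zA k s.re (i + (M + 2)) := by
    have := norm_tsum_le_tsum_norm (f := fun i => zT k (i + (M + 2)) s)
      ((summable_nat_add_iff (f := fun n => ‖zT k n s‖) (M + 2)).mpr hsumN)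
    simpa only [norm_zT] using this
  have := norm_add_le (∑ i ∈ Finset.range M, zT k i s) (∑' i, zT k (i + (M + 2)) s)
  rw [norm_zT, norm_zT]
  rw [show M + 1 + 1 = M + 2 by omega] at htail
  linarith


/-- Existence of a fixed point of a holomorphic self-map of a disc. -/
lemma disc_fixed_exists (t : ℝ) (ht : 0 < t) (φ : ℂ → ℂ)
    (hd : DiffContOnCl ℂ φ (Metric.ball 0 t))
    (hb : ∀ x ∈ Metric.closedBall (0 : ℂ) t, ‖φ x‖ < t) :
    ∃ x ∈ Metric.ball (0 : ℂ) t, φ x = x := by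
  by_contra hcon
  push Not at hcon
  have hne : ∀ x ∈ closure (Metric.ball (0 : ℂ) t), x - φ x ≠ 0 := by
    intro x hx h
    rw [closure_ball _ ht.ne'] at hx
    have h1 : φ x = x := (sub_eq_zero.mp h).symm
    have h2 := hb x hx
    rw [h1] at h2
    exact hcon x (by simpa using h2) h1
  have hid : DiffContOnCl ℂ (fun x : ℂ => x) (Metric.ball 0 t) := differentiable_id.diffContOnCl
  have hG : DiffContOnCl ℂ (fun x => Complex.exp (-(x * (x - φ x)⁻¹))) (Metric.ball 0 t) :=
    Complex.differentiable_exp.comp_diffContOnCl (hid.smul ((hid.sub hd).inv hne)).neg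
  have key := Complex.norm_le_of_forall_mem_frontier_norm_le (C := Real.exp (-(1/2)))
    Metric.isBounded_ball hG ?_ (subset_closure (Metric.mem_ball_self ht))
  · simp at key
    linarith
  · intro x hx
    rw [frontier_ball _ ht.ne'] at hx
    have hx' : ‖x‖ = t := by simpa using hx
    have h2 := hb x (Metric.sphere_subset_closedBall hx)
    have h3 := hne x (by rw [closure_ball _ ht.ne']; exact Metric.sphere_subset_closedBall hx)
    rw [Complex.norm_exp, Real.exp_le_exp, Complex.neg_re, neg_le_neg_iff,
      ← div_eq_mul_inv, Complex.div_re, ← add_div, le_div_iff₀ (Complex.normSq_pos.mpr h3)]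
    have e1 : Complex.normSq x = t ^ 2 := by rw [Complex.normSq_eq_norm_sq, hx']
    have e2 : Complex.normSq (φ x) ≤ t ^ 2 := by
      rw [Complex.normSq_eq_norm_sq]; gcongr
    rw [Complex.normSq_apply] at *
    simp only [Complex.sub_re, Complex.sub_im]
    nlinarith

/-- Uniqueness of the fixed point. -/
lemma disc_fixed_unique (t : ℝ) (ht : 0 < t) (φ : ℂ → ℂ)
    (hd : DiffContOnCl ℂ φ (Metric.ball 0 t))
    (hb : ∀ x ∈ Metric.closedBall (0 : ℂ) t, ‖φ x‖ < t)
    (a b : ℂ) (ha : a ∈ Metric.ball (0 : ℂ) t) (hbb : b ∈ Metric.ball (0 : ℂ) t)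
    (hfa : φ a = a) (hfb : φ b = b) : a = b := by
  by_contra hab
  have hcl : closure (Metric.ball (0 : ℂ) t) = Metric.closedBall 0 t := closure_ball _ ht.ne'
  have haN : ‖a‖ < t := by simpa using ha
  have hid : DiffContOnCl ℂ (fun x : ℂ => x) (Metric.ball 0 t) := differentiable_id.diffContOnCl
  have hslope : DiffContOnCl ℂ (dslope φ a) (Metric.ball 0 t) := by
    constructor
    · exact (Complex.differentiableOn_dslope (Metric.isOpen_ball.mem_nhds ha)).mpr
        hd.differentiableOn
    · refine (continuousOn_dslope ?_).mpr ⟨hd.continuousOn, ?_⟩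
      · exact Filter.mem_of_superset (Metric.isOpen_ball.mem_nhds ha) subset_closure
      · exact hd.differentiableAt Metric.isOpen_ball ha
  have hden : ∀ y : ℂ, ‖y‖ ≤ t → (t : ℂ) ^ 2 - starRingEnd ℂ a * y ≠ 0 := by
    intro y hy h
    have h1 : (t : ℂ) ^ 2 = starRingEnd ℂ a * y := sub_eq_zero.mp h
    have h2 := congrArg norm h1
    simp [abs_of_pos ht] at h2
    nlinarith [norm_nonneg y, norm_nonneg a]
  have hden' : ∀ x ∈ closure (Metric.ball (0 : ℂ) t), (t : ℂ) ^ 2 - starRingEnd ℂ a * φ x ≠ 0 := by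
    intro x hx
    rw [hcl] at hx
    exact hden _ (hb x hx).le
  have hcst : DiffContOnCl ℂ (fun _ : ℂ => (t : ℂ) ^ 2) (Metric.ball 0 t) := diffContOnCl_const
  have hh : DiffContOnCl ℂ (fun x => dslope φ a x * (((t : ℂ) ^ 2 - starRingEnd ℂ a * x) *
      ((t : ℂ) ^ 2 - starRingEnd ℂ a * φ x)⁻¹)) (Metric.ball 0 t) :=
    hslope.smul ((hcst.sub (hid.const_smul (starRingEnd ℂ a))).smul
      ((hcst.sub (hd.const_smul (starRingEnd ℂ a))).inv hden'))
  -- maximum on the sphere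
  have hcomp : IsCompact (Metric.sphere (0 : ℂ) t) := isCompact_sphere _ _
  have hneS : (Metric.sphere (0 : ℂ) t).Nonempty := NormedSpace.sphere_nonempty.mpr ht.le
  obtain ⟨x₀, hx₀, hmax⟩ := hcomp.exists_isMaxOn hneS
    ((hh.continuousOn.mono (by rw [hcl]; exact Metric.sphere_subset_closedBall)).norm)
  have hval : ∀ x : ℂ, x ≠ a → dslope φ a x * (((t : ℂ) ^ 2 - starRingEnd ℂ a * x) *
      ((t : ℂ) ^ 2 - starRingEnd ℂ a * φ x)⁻¹) = ((φ x - a) * ((t : ℂ) ^ 2 - starRingEnd ℂ a * x)) /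
      ((x - a) * ((t : ℂ) ^ 2 - starRingEnd ℂ a * φ x)) := by
    intro x hx
    rw [dslope_of_ne _ hx, slope_def_field, hfa]
    rw [div_mul_eq_mul_div, div_eq_div_iff_comm] <;> simp [div_eq_mul_inv] <;> ring
  have hbig := Complex.norm_le_of_forall_mem_frontier_norm_le Metric.isBounded_ball hh
    (fun x hx => hmax (by rwa [frontier_ball _ ht.ne'] at hx)) (subset_closure hbb)
  have hlt : ‖dslope φ a x₀ * (((t : ℂ) ^ 2 - starRingEnd ℂ a * x₀) *
      ((t : ℂ) ^ 2 - starRingEnd ℂ a * φ x₀)⁻¹)‖ < 1 := by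
    have hx₀' : ‖x₀‖ = t := by simpa using hx₀
    have hne : x₀ ≠ a := by rintro rfl; linarith
    have hpos : 0 < ‖(x₀ - a) * ((t : ℂ) ^ 2 - starRingEnd ℂ a * φ x₀)‖ := by
      rw [norm_pos_iff]
      exact mul_ne_zero (sub_ne_zero.mpr hne)
        (hden _ (hb _ (Metric.sphere_subset_closedBall hx₀)).le)
    rw [hval _ hne, norm_div, div_lt_one hpos]
    have h2 := hb x₀ (Metric.sphere_subset_closedBall hx₀)
    have e0 : ‖(t : ℂ) ^ 2 - starRingEnd ℂ a * x₀‖ ^ 2 = t ^ 2 * ‖x₀ - a‖ ^ 2 := by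
      have e1 : Complex.normSq x₀ = t ^ 2 := by rw [Complex.normSq_eq_norm_sq, hx₀']
      rw [← Complex.normSq_eq_norm_sq, ← Complex.normSq_eq_norm_sq]
      rw [← Complex.ofReal_pow]
      simp only [Complex.normSq_apply] at e1 ⊢
      simp [-Complex.ofReal_pow]
      linear_combination (a.re ^ 2 + a.im ^ 2 - t ^ 2) * e1
    have e3 : t ^ 2 * ‖φ x₀ - a‖ ^ 2 < ‖(t : ℂ) ^ 2 - starRingEnd ℂ a * φ x₀‖ ^ 2 := by
      have e1 : Complex.normSq (φ x₀) < t ^ 2 := by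
        rw [Complex.normSq_eq_norm_sq]; gcongr
      have e2 : Complex.normSq a < t ^ 2 := by
        rw [Complex.normSq_eq_norm_sq]; gcongr
      rw [← Complex.normSq_eq_norm_sq, ← Complex.normSq_eq_norm_sq]
      rw [← Complex.ofReal_pow]
      simp only [Complex.normSq_apply] at e1 e2 ⊢
      simp [-Complex.ofReal_pow]
      nlinarith [mul_pos (sub_pos.mpr e1) (sub_pos.mpr e2)]
    have hpos2 : 0 < ‖x₀ - a‖ := by rw [norm_pos_iff]; exact sub_ne_zero.mpr hne
    rw [norm_mul, norm_mul]
    refine lt_of_pow_lt_pow_left₀ 2 (by positivity) ?_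
    rw [mul_pow, mul_pow, e0]
    have := mul_lt_mul_of_pos_left e3 (by positivity : 0 < ‖x₀ - a‖ ^ 2)
    linarith
  have hone : dslope φ a b * (((t : ℂ) ^ 2 - starRingEnd ℂ a * b) *
      ((t : ℂ) ^ 2 - starRingEnd ℂ a * φ b)⁻¹) = 1 := by
    rw [hval b (Ne.symm hab), hfb]
    apply div_self
    exact mul_ne_zero (sub_ne_zero.mpr (Ne.symm hab)) (hden _ (le_of_lt (by simpa using hbb)))
  rw [hone] at hbig
  simp only [norm_one] at hbig
  exact absurd (lt_of_le_of_lt hbig hlt) (lt_irrefl _)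

lemma rect_abstract (L c h : ℝ) (j : ℕ) (hL : 0 < L) (hh : Real.log 3 ≤ L * h) (r : ℂ → ℂ)
    (hd : ∀ s : ℂ, c - h ≤ s.re → s.re ≤ c + h → DifferentiableAt ℂ r s)
    (hr : ∀ s : ℂ, c - h ≤ s.re → s.re ≤ c + h →
      ‖r s‖ < (1 + ‖Complex.exp (L * (c - s))‖) / 2) :
    ∃! s : ℂ, (c - h < s.re ∧ s.re < c + h) ∧
      (2 * Real.pi * j / L < s.im ∧ s.im < 2 * Real.pi * ((j : ℝ) + 1) / L) ∧
      1 + Complex.exp (L * (c - s)) + r s = 0 := by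
  have hLc : (L : ℂ) ≠ 0 := by exact_mod_cast hL.ne'
  have hpi := Real.pi_pos
  set V : ℂ → ℂ := fun x => (1 - x) / (1 + x) with hV
  set S : ℂ → ℂ := fun x => c - (2 * Complex.log (V x) - Real.pi * (2 * j + 1) * Complex.I) / L
    with hS
  set φ : ℂ → ℂ := fun x => -(r (S x)) * (1 + x) ^ 2 / 4 with hφ
  set t : ℝ := 2 - Real.sqrt 3 with ht
  have hsq : Real.sqrt 3 ^ 2 = 3 := Real.sq_sqrt (by norm_num)
  have hs3 : 0 ≤ Real.sqrt 3 := Real.sqrt_nonneg 3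
  have ht0 : 0 < t := by nlinarith
  have ht1 : t < 1 := by nlinarith
  have htt : 1 + t ^ 2 = 4 * t := by rw [ht]; nlinarith
  -- basic facts for `‖x‖ < 1`
  have hne : ∀ x : ℂ, ‖x‖ < 1 → 1 + x ≠ 0 := by
    intro x hx h0
    have : x = -1 := by linear_combination h0
    rw [this] at hx; simp at hx
  have hnsq : ∀ x : ℂ, ‖1 - x‖ ^ 2 + ‖1 + x‖ ^ 2 = 2 * (1 + ‖x‖ ^ 2) := by
    intro x
    simp only [← Complex.normSq_eq_norm_sq, Complex.normSq_apply]
    simp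
    ring
  have hVre : ∀ x : ℂ, ‖x‖ < 1 → 0 < (V x).re := by
    intro x hx
    have hp : 0 < Complex.normSq (1 + x) := Complex.normSq_pos.mpr (hne x hx)
    have hx2 : x.re * x.re + x.im * x.im < 1 := by
      rw [← Complex.normSq_apply, Complex.normSq_eq_norm_sq]
      nlinarith [norm_nonneg x]
    simp only [hV]
    rw [Complex.div_re, ← add_div]
    apply div_pos _ hp
    simp
    nlinarith
  have hVne : ∀ x : ℂ, ‖x‖ < 1 → V x ≠ 0 := by
    intro x hx h0
    have := hVre x hx
    rw [h0] at this; simp at this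
  have hLS : ∀ x : ℂ, (L : ℂ) * (c - S x) =
      2 * Complex.log (V x) - Real.pi * (2 * j + 1) * Complex.I := by
    intro x
    simp only [hS]
    field_simp
    ring
  have hodd : Complex.exp (-(Real.pi * (2 * j + 1) * Complex.I)) = -1 := by
    have e : -((Real.pi : ℂ) * (2 * j + 1) * Complex.I) =
        -(Real.pi * Complex.I) + ((-(j : ℤ) : ℤ) : ℂ) * (2 * Real.pi * Complex.I) := by
      push_cast; ring
    rw [e, Complex.exp_add, Complex.exp_int_mul_two_pi_mul_I, Complex.exp_neg, Complex.exp_pi_mul_I]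
    norm_num
  have f1 : ∀ x : ℂ, ‖x‖ < 1 → Complex.exp (L * (c - S x)) = -(V x) ^ 2 := by
    intro x hx
    rw [hLS, sub_eq_add_neg, Complex.exp_add, hodd, two_mul, Complex.exp_add,
      Complex.exp_log (hVne x hx)]
    ring
  have hSre : ∀ x : ℂ, L * (c - (S x).re) = 2 * Real.log ‖V x‖ := by
    intro x
    have := congrArg Complex.re (hLS x)
    simpa [Complex.log_re] using this
  have hSim : ∀ x : ℂ, L * (S x).im = Real.pi * (2 * j + 1) - 2 * (V x).arg := by
    intro x
    have := congrArg Complex.im (hLS x)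
    simp [Complex.log_im] at this
    linarith
  have f2 : ∀ x : ℂ, ‖x‖ < 1 →
      2 * Real.pi * j / L < (S x).im ∧ (S x).im < 2 * Real.pi * ((j : ℝ) + 1) / L := by
    intro x hx
    have h1 := hSim x
    have h2 : |(V x).arg| < Real.pi / 2 := Complex.abs_arg_lt_pi_div_two_iff.mpr (Or.inl (hVre x hx))
    rw [abs_lt] at h2
    rw [div_lt_iff₀ hL, lt_div_iff₀ hL]
    constructor <;> nlinarith
  have hV3 : ∀ x : ℂ, ‖x‖ < 1 → 4 * ‖x‖ ≤ 1 + ‖x‖ ^ 2 →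
      2 * Real.log ‖V x‖ ≤ Real.log 3 ∧ -Real.log 3 ≤ 2 * Real.log ‖V x‖ := by
    intro x hx h4
    have hp : 0 < ‖V x‖ := norm_pos_iff.mpr (hVne x hx)
    have hp1 : 0 < ‖1 + x‖ := norm_pos_iff.mpr (hne x hx)
    have habs := Complex.abs_re_le_norm x
    rw [abs_le] at habs
    have e1 : ‖1 + x‖ ^ 2 = 1 + 2 * x.re + ‖x‖ ^ 2 := by
      simp only [← Complex.normSq_eq_norm_sq, Complex.normSq_apply]
      simp
      ring
    have e2 := hnsq x
    have e3 : ‖V x‖ ^ 2 = ‖1 - x‖ ^ 2 / ‖1 + x‖ ^ 2 := by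
      simp only [hV, norm_div, div_pow]
    have e4 : 2 * Real.log ‖V x‖ = Real.log (‖V x‖ ^ 2) := by rw [Real.log_pow]; norm_num
    rw [e4, ← Real.log_inv]
    constructor
    · apply Real.log_le_log (by positivity)
      rw [e3, div_le_iff₀ (by positivity)]
      linarith
    · apply Real.log_le_log (by positivity)
      rw [e3, le_div_iff₀ (by positivity)]
      linarith
  have hV3' : ∀ x : ℂ, ‖x‖ < 1 → 4 * ‖x‖ < 1 + ‖x‖ ^ 2 →
      2 * Real.log ‖V x‖ < Real.log 3 ∧ -Real.log 3 < 2 * Real.log ‖V x‖ := by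
    intro x hx h4
    have hp : 0 < ‖V x‖ := norm_pos_iff.mpr (hVne x hx)
    have hp1 : 0 < ‖1 + x‖ := norm_pos_iff.mpr (hne x hx)
    have habs := Complex.abs_re_le_norm x
    rw [abs_le] at habs
    have e1 : ‖1 + x‖ ^ 2 = 1 + 2 * x.re + ‖x‖ ^ 2 := by
      simp only [← Complex.normSq_eq_norm_sq, Complex.normSq_apply]
      simp
      ring
    have e2 := hnsq x
    have e3 : ‖V x‖ ^ 2 = ‖1 - x‖ ^ 2 / ‖1 + x‖ ^ 2 := by
      simp only [hV, norm_div, div_pow]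
    have e4 : 2 * Real.log ‖V x‖ = Real.log (‖V x‖ ^ 2) := by rw [Real.log_pow]; norm_num
    rw [e4, ← Real.log_inv]
    constructor
    · apply Real.log_lt_log (by positivity)
      rw [e3, div_lt_iff₀ (by positivity)]
      linarith
    · apply Real.log_lt_log (by positivity)
      rw [e3, lt_div_iff₀ (by positivity)]
      linarith
  have f3 : ∀ x : ℂ, ‖x‖ ≤ t → c - h ≤ (S x).re ∧ (S x).re ≤ c + h := by
    intro x hx
    have h1 := hV3 x (by linarith) (by nlinarith [norm_nonneg x])
    have h2 := hSre x
    constructor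
    · have : L * (c - (S x).re) ≤ L * h := by linarith
      have := le_of_mul_le_mul_left this hL
      linarith
    · have : L * ((S x).re - c) ≤ L * h := by linarith
      have := le_of_mul_le_mul_left this hL
      linarith
  have f3' : ∀ x : ℂ, ‖x‖ < t → c - h < (S x).re ∧ (S x).re < c + h := by
    intro x hx
    have h1 := hV3' x (by linarith) (by nlinarith [norm_nonneg x])
    have h2 := hSre x
    constructor
    · have : L * (c - (S x).re) < L * h := by linarith
      have := lt_of_mul_lt_mul_left this hL.le
      linarith
    · have : L * ((S x).re - c) < L * h := by linarith
      have := lt_of_mul_lt_mul_left this hL.le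
      linarith
  have f4 : ∀ x : ℂ, ‖x‖ < 1 → c - h ≤ (S x).re → (S x).re ≤ c + h →
      ‖φ x‖ < (1 + ‖x‖ ^ 2) / 4 := by
    intro x hx ha hb
    have h1 := hr (S x) ha hb
    rw [f1 x hx, norm_neg, norm_pow] at h1
    have hp1 : 0 < ‖1 + x‖ := norm_pos_iff.mpr (hne x hx)
    have e3 : ‖V x‖ ^ 2 * ‖1 + x‖ ^ 2 = ‖1 - x‖ ^ 2 := by
      simp only [hV, norm_div, div_pow]
      field_simp
    have e2 := hnsq x
    have h2 := mul_lt_mul_of_pos_right h1 (by positivity : 0 < ‖1 + x‖ ^ 2)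
    have h3 : ‖φ x‖ = ‖r (S x)‖ * ‖1 + x‖ ^ 2 / 4 := by
      simp [hφ]
    rw [h3]
    nlinarith
  have f5 : ∀ x : ℂ, ‖x‖ < 1 → (1 + Complex.exp (L * (c - S x)) + r (S x) = 0 ↔ φ x = x) := by
    intro x hx
    rw [f1 x hx]
    have h1 := hne x hx
    have e : V x * (1 + x) = 1 - x := by simp only [hV]; field_simp
    have e' : (1 + -(V x) ^ 2 + r (S x)) * (1 + x) ^ 2 = 4 * (x - φ x) := by
      simp only [hφ]
      linear_combination (-(V x * (1 + x)) - (1 - x)) * e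
    constructor
    · intro h0
      rw [h0, zero_mul] at e'
      have : x - φ x = 0 := by
        have := e'.symm
        simpa using this
      linear_combination -this
    · intro h0
      rw [h0, sub_self, mul_zero] at e'
      exact (mul_eq_zero.mp e').resolve_right (pow_ne_zero 2 h1)
  have hdiff : DiffContOnCl ℂ φ (Metric.ball 0 t) := by
    apply DifferentiableOn.diffContOnCl
    rw [closure_ball _ ht0.ne']
    intro x hx
    have hx' : ‖x‖ ≤ t := by simpa using hx
    have hx1 : ‖x‖ < 1 := by linarith
    have d1 : DifferentiableAt ℂ V x := by
      simp only [hV]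
      exact DifferentiableAt.div (by fun_prop) (by fun_prop) (hne x hx1)
    have d2 : DifferentiableAt ℂ S x := by
      simp only [hS]
      have := d1.clog (Or.inl (hVre x hx1))
      fun_prop
    have d3 : DifferentiableAt ℂ (fun y => r (S y)) x :=
      DifferentiableAt.comp (g := r) x (hd _ (f3 x hx').1 (f3 x hx').2) d2
    have : DifferentiableAt ℂ φ x := by
      have d5 : DifferentiableAt ℂ (fun y : ℂ => (1 + y) ^ 2) x := by fun_prop
      exact (d3.neg.mul d5).div_const 4
    exact this.differentiableWithinAt
  have hself : ∀ x ∈ Metric.closedBall (0 : ℂ) t, ‖φ x‖ < t := by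
    intro x hx
    have hx' : ‖x‖ ≤ t := by simpa using hx
    have h1 := f4 x (by linarith) (f3 x hx').1 (f3 x hx').2
    have : ‖x‖ ^ 2 ≤ t ^ 2 := by gcongr
    linarith
  -- every zero in the rectangle comes from a fixed point in the disc
  have hconv : ∀ s : ℂ, (c - h < s.re ∧ s.re < c + h) ∧
      (2 * Real.pi * j / L < s.im ∧ s.im < 2 * Real.pi * ((j : ℝ) + 1) / L) ∧
      1 + Complex.exp (L * (c - s)) + r s = 0 → ∃ x ∈ Metric.ball (0 : ℂ) t, S x = s ∧ φ x = x := by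
    rintro s ⟨⟨ha, hb⟩, ⟨hc1, hc2⟩, h0⟩
    set z : ℂ := (L * (c - s) + Real.pi * (2 * j + 1) * Complex.I) / 2 with hz
    have hzim : z.im = (Real.pi * (2 * j + 1) - L * s.im) / 2 := by
      have : 2 * z = L * (c - s) + Real.pi * (2 * j + 1) * Complex.I := by rw [hz]; ring
      have := congrArg Complex.im this
      simp at this
      linarith
    rw [div_lt_iff₀ hL] at hc1
    rw [lt_div_iff₀ hL] at hc2
    have hz1 : -(Real.pi / 2) < z.im := by rw [hzim]; nlinarith
    have hz2 : z.im < Real.pi / 2 := by rw [hzim]; nlinarith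
    set v := Complex.exp z with hv
    have hvre : 0 < v.re := by
      rw [hv, Complex.exp_re]
      exact mul_pos (Real.exp_pos _) (Real.cos_pos_of_mem_Ioo ⟨hz1, hz2⟩)
    have hvne : 1 + v ≠ 0 := by
      intro h
      have := congrArg Complex.re h
      simp at this
      linarith
    have hlog : Complex.log v = z := Complex.log_exp (by linarith) (by linarith)
    set x := (1 - v) / (1 + v) with hx
    have hx1 : ‖x‖ < 1 := by
      rw [hx, norm_div, div_lt_one (norm_pos_iff.mpr hvne)]
      refine lt_of_pow_lt_pow_left₀ 2 (by positivity) ?_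
      simp only [← Complex.normSq_eq_norm_sq, Complex.normSq_apply]
      simp
      nlinarith
    have hVx : V x = v := by
      have hxe : x * (1 + v) = 1 - v := by rw [hx]; field_simp
      simp only [hV]
      rw [div_eq_iff (hne x hx1)]
      linear_combination -hxe
    have hSx : S x = s := by
      simp only [hS]
      rw [hVx, hlog, hz]
      field_simp
      ring
    have hfix : φ x = x := (f5 x hx1).mp (by rw [hSx]; exact h0)
    have h4 := f4 x hx1 (by rw [hSx]; exact ha.le) (by rw [hSx]; exact hb.le)
    rw [hfix] at h4
    refine ⟨x, ?_, hSx, hfix⟩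
    have : ‖x‖ < t := by
      by_contra hcon
      push Not at hcon
      have : ‖x‖ ^ 2 - 4 * ‖x‖ + 1 = (‖x‖ - t) * (‖x‖ + t - 4) := by linear_combination htt
      nlinarith
    simpa using this
  obtain ⟨x, hx, hfix⟩ := disc_fixed_exists t ht0 φ hdiff hself
  have hxt : ‖x‖ < t := by simpa using hx
  refine ⟨S x, ⟨f3' x hxt, f2 x (by linarith), (f5 x (by linarith)).mpr hfix⟩, ?_⟩
  intro s hs
  obtain ⟨y, hy, hSy, hfy⟩ := hconv s hs
  rw [← hSy, disc_fixed_unique t ht0 φ hdiff hself y x hy hx hfy hfix]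

lemma zT_step (k : ℕ) (s : ℂ) {n : ℕ} (hn : 2 ≤ n) :
    zT k (n + 1) s = zT k n s * Complex.exp
      (((Real.log ((n : ℝ) + 1) - Real.log n : ℝ) : ℂ) * (((q n * k : ℝ) : ℂ) - s)) := by
  have h1 := log_nat_pos hn
  have h2 := L_pos hn
  have h3 : Real.log ((n : ℝ) + 1) =
      Real.log n * Real.exp (q n * (Real.log ((n : ℝ) + 1) - Real.log n)) := by
    rw [q_eq hn, Real.exp_sub, Real.exp_log (by linarith), Real.exp_log h1]
    field_simp
  unfold zT
  rw [show ((n + 1 : ℕ) : ℝ) = (n : ℝ) + 1 by push_cast; ring]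
  generalize Real.log n = a at *
  generalize Real.log ((n : ℝ) + 1) = b at *
  nth_rewrite 1 [h3]
  push_cast
  rw [mul_pow, ← Complex.exp_nat_mul, mul_assoc, mul_assoc, ← Complex.exp_add, ← Complex.exp_add]
  congr 2
  ring

lemma zT_ne (k : ℕ) (s : ℂ) {n : ℕ} (hn : 2 ≤ n) : zT k n s ≠ 0 := by
  rw [← norm_pos_iff, norm_zT]
  exact zA_pos k _ hn

lemma zT_diff (k n : ℕ) : Differentiable ℂ (zT k n) := by
  unfold zT
  fun_prop

/-- If the critical strip `S_M^k` exists, then each rectangle of `S_M^k` delimited by the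
heights `2πj/(log(M+1)-log M)` and `2π(j+1)/(log(M+1)-log M)` contains exactly one zero
of the `k`-th derivative of the Riemann zeta function. -/
theorem zeta_deriv_unique_zero_in_rectangle (M k : ℕ) (hM : 2 ≤ M) (hk : 3 ≤ k)
    (hex : q (M + 1) * k + ((M : ℝ) + 2) * Real.log 3 <
      q M * k - ((M : ℝ) + 1) * Real.log 3)
    (j : ℕ) :
    ∃! s : ℂ,
      (q M * k - ((M : ℝ) + 1) * Real.log 3 < s.re ∧
        s.re < q M * k + ((M : ℝ) + 1) * Real.log 3) ∧
      (2 * Real.pi * j / (Real.log ((M : ℝ) + 1) - Real.log M) < s.im ∧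
        s.im < 2 * Real.pi * ((j : ℝ) + 1) / (Real.log ((M : ℝ) + 1) - Real.log M)) ∧
      iteratedDeriv k riemannZeta s = 0 := by
  have hL : 0 < Real.log ((M : ℝ) + 1) - Real.log M := sub_pos.mpr (L_pos hM)
  have hl3 : 0 < Real.log 3 := Real.log_pos (by norm_num)
  have hh : Real.log 3 ≤ (Real.log ((M : ℝ) + 1) - Real.log M) * (((M : ℝ) + 1) * Real.log 3) := by
    have h1 := L_ge hM
    calc Real.log 3 = 1 / ((M : ℝ) + 1) * (((M : ℝ) + 1) * Real.log 3) := by field_simp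
      _ ≤ _ := by gcongr
  have key := rect_abstract (Real.log ((M : ℝ) + 1) - Real.log M) (q M * k)
    (((M : ℝ) + 1) * Real.log 3) j hL hh
    (fun s => ((-1) ^ k * iteratedDeriv k riemannZeta s - zT k M s - zT k (M + 1) s) / zT k M s)
    (by
      intro s h1 h2
      have hs := (rest_bound M k hM hk hex s h1 h2).1
      have d1 := zeta_iter_diffAt k s hs
      have d2 := (zT_diff k M) s
      have d3 := (zT_diff k (M + 1)) s
      exact (((d1.const_mul _).sub d2).sub d3).div d2 (zT_ne k s hM))
    (by
      intro s h1 h2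
      have hs := (rest_bound M k hM hk hex s h1 h2).2
      have hp : 0 < ‖zT k M s‖ := norm_pos_iff.mpr (zT_ne k s hM)
      rw [norm_div, div_lt_iff₀ hp]
      refine hs.trans_eq ?_
      rw [zT_step k s hM, norm_mul]
      ring)
  have hiff : ∀ s : ℂ, (1 + Complex.exp (((Real.log ((M : ℝ) + 1) - Real.log M : ℝ) : ℂ) *
      (((q M * k : ℝ) : ℂ) - s)) +
      ((-1) ^ k * iteratedDeriv k riemannZeta s - zT k M s - zT k (M + 1) s) / zT k M s = 0) ↔
      iteratedDeriv k riemannZeta s = 0 := by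
    intro s
    have hne := zT_ne k s hM
    have e : 1 + Complex.exp (((Real.log ((M : ℝ) + 1) - Real.log M : ℝ) : ℂ) *
      (((q M * k : ℝ) : ℂ) - s)) +
      ((-1) ^ k * iteratedDeriv k riemannZeta s - zT k M s - zT k (M + 1) s) / zT k M s =
      (-1) ^ k * iteratedDeriv k riemannZeta s / zT k M s := by
      rw [zT_step k s hM]
      field_simp
      ring
    rw [e]
    simp [hne]
  simpa only [hiff] using key
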